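/- arXiv:2312.16489 — 8 statements merged into one kernel-verified Lean document; each statement's English description precedes it below -/
import Mathlib

section
/- Fix an integer K ≥ 1 and a real β > 0. Let p be a probability vector on Fin K with p(a) > 0 for all a, let q be any probability vector on Fin K, and let ℓ : Fin K → ℝ. Then Σ_a ℓ(a)·(p(a) − q(a)) − β·KL(q‖p) ≤ β·Σ_a p(a)·ξ(ℓ(a)/β), where ξ(x) = exp(−x) + x − 1. -/
open Finset

/-- `q` is a probability vector on `Fin K`. -/
def IsProbVec {K : ℕ} (q : Fin K → ℝ) : Prop :=
  (∀ a, 0 ≤ q a) ∧ ∑ a, q a = 1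

/-- Kullback–Leibler divergence `KL(q‖p) = ∑ a, q a · log (q a / p a)`.
(In Lean, `0 * Real.log (0 / p a) = 0`, matching the convention `0·log 0 = 0`.) -/
noncomputable def klDiv {K : ℕ} (q p : Fin K → ℝ) : ℝ :=
  ∑ a, q a * Real.log (q a / p a)

/-- ξ(x) = exp(−x) + x − 1 -/
noncomputable def xi (x : ℝ) : ℝ := Real.exp (-x) + x - 1

/-- Proposition 7 (Lemma 8 of Ito et al. 2022): the FTRL stability bound
`⟨ℓ, p − q⟩ − β·KL(q‖p) ≤ β·∑ a, p a·ξ(ℓ a/β)`. -/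
theorem ftrl_stability_xi
    (K : ℕ) (hK : 1 ≤ K) (β : ℝ) (hβ : 0 < β)
    (p : Fin K → ℝ) (hp : IsProbVec p) (hppos : ∀ a, 0 < p a)
    (q : Fin K → ℝ) (hq : IsProbVec q) (ℓ : Fin K → ℝ) :
    (∑ a, ℓ a * (p a - q a)) - β * klDiv q p ≤ β * ∑ a, p a * xi (ℓ a / β) := by
  have key : ∀ a, ℓ a * (p a - q a) - β * (q a * Real.log (q a / p a))
      ≤ β * (p a * xi (ℓ a / β)) + β * (p a - q a) := by
    intro a
    obtain ⟨x, hx⟩ : ∃ x, x = ℓ a / β := ⟨_, rfl⟩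
    have hl : ℓ a = β * x := by rw [hx]; field_simp
    rw [← hx, hl]
    have hpa := hppos a
    have main : -x * q a - q a * Real.log (q a / p a) + q a ≤ p a * Real.exp (-x) := by
      rcases (hq.1 a).eq_or_lt with h | h
      · rw [← h]
        have := Real.exp_pos (-x)
        simp only [mul_zero, zero_mul, sub_zero, add_zero]
        positivity
      · have h1 := Real.add_one_le_exp (-x - Real.log (q a / p a))
        rw [Real.exp_sub, Real.exp_log (div_pos h hpa)] at h1
        have h2 := mul_le_mul_of_nonneg_left h1 h.le
        have h3 : q a * (Real.exp (-x) / (q a / p a)) = p a * Real.exp (-x) := by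
          field_simp
        rw [h3] at h2
        linarith
    have h4 := mul_le_mul_of_nonneg_left main hβ.le
    unfold xi
    linarith
  have hs := Finset.sum_le_sum (fun a (_ : a ∈ Finset.univ) => key a)
  rw [Finset.sum_sub_distrib, Finset.sum_add_distrib, ← Finset.mul_sum, ← Finset.mul_sum,
    ← Finset.mul_sum, Finset.sum_sub_distrib, hp.2, hq.2] at hs
  unfold klDiv
  linarith
end

section
/- Fix an integer K ≥ 1 and a real β > 0. Let p be a probability vector on Fin K with p(a) > 0 for all a, let q be any probability vector on Fin K, and let ℓ : Fin K → ℝ satisfy ℓ(a) ≥ −β for all a. Then Σ_a ℓ(a)·(p(a) − q(a)) − β·KL(q‖p) ≤ (1/β)·Σ_a p(a)·ℓ(a)². -/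
open Finset

theorem exp_neg_le_aux (x : ℝ) (hx : -1 ≤ x) : Real.exp (-x) ≤ 1 - x + x ^ 2 := by
  by_cases h : x ≤ 1
  · have h1 : |(-x)| ≤ 1 := by rw [abs_neg]; exact abs_le.mpr ⟨hx, h⟩
    have h2 := (abs_le.mp (Real.abs_exp_sub_one_sub_id_le h1)).2
    nlinarith
  · have h1 : Real.exp (-x) ≤ 1 := Real.exp_le_one_iff.mpr (by linarith)
    nlinarith

theorem term_aux (p q x : ℝ) (hp : 0 < p) (hq : 0 ≤ q) (hx : -1 ≤ x) :
    x * (p - q) - q * Real.log (q / p) ≤ p * x ^ 2 + (p - q) := by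
  have he := mul_le_mul_of_nonneg_left (exp_neg_le_aux x hx) hp.le
  have key : -(q * x) - q * Real.log (q / p) ≤ p * Real.exp (-x) - q := by
    rcases hq.eq_or_lt with h | h
    · subst h
      have := mul_pos hp (Real.exp_pos (-x))
      simp only [zero_mul]
      linarith
    · have hpos : 0 < p * Real.exp (-x) / q := by positivity
      have h1 := Real.log_le_sub_one_of_pos hpos
      have h2 : Real.log (p * Real.exp (-x) / q) = -x - Real.log (q / p) := by
        rw [Real.log_div (by positivity) h.ne', Real.log_mul hp.ne' (Real.exp_pos _).ne',
          Real.log_exp, Real.log_div h.ne' hp.ne']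
        ring
      rw [h2] at h1
      have h3 := mul_le_mul_of_nonneg_left h1 h.le
      have h4 : q * (p * Real.exp (-x) / q - 1) = p * Real.exp (-x) - q := by
        field_simp
      rw [h4] at h3
      linarith
  linarith

/-- Stability bound used in the regret decomposition: if `ℓ a ≥ −β` for all `a`, then
`⟨ℓ, p − q⟩ − β·KL(q‖p) ≤ (1/β)·∑ a, p a·(ℓ a)²`. -/
theorem ftrl_stability_sq
    (K : ℕ) (hK : 1 ≤ K) (β : ℝ) (hβ : 0 < β)
    (p : Fin K → ℝ) (hp : IsProbVec p) (hppos : ∀ a, 0 < p a)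
    (q : Fin K → ℝ) (hq : IsProbVec q)
    (ℓ : Fin K → ℝ) (hℓ : ∀ a, -β ≤ ℓ a) :
    (∑ a, ℓ a * (p a - q a)) - β * klDiv q p ≤ (1 / β) * ∑ a, p a * (ℓ a) ^ 2 := by
  have hb : β ≠ 0 := hβ.ne'
  have hs : ∑ a, (p a - q a) = 0 := by
    rw [Finset.sum_sub_distrib, hp.2, hq.2, sub_self]
  have ht : ∀ a, ℓ a * (p a - q a) - β * (q a * Real.log (q a / p a))
      ≤ (1 / β) * (p a * (ℓ a) ^ 2) + β * (p a - q a) := by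
    intro a
    have hx : -1 ≤ ℓ a / β := by
      rw [le_div_iff₀ hβ]
      linarith [hℓ a]
    have h := mul_le_mul_of_nonneg_left (term_aux (p a) (q a) (ℓ a / β) (hppos a) (hq.1 a) hx) hβ.le
    have e1 : β * (ℓ a / β * (p a - q a) - q a * Real.log (q a / p a))
        = ℓ a * (p a - q a) - β * (q a * Real.log (q a / p a)) := by
      field_simp
    have e2 : β * (p a * (ℓ a / β) ^ 2 + (p a - q a))
        = (1 / β) * (p a * (ℓ a) ^ 2) + β * (p a - q a) := by
      field_simp
    rwa [e1, e2] at h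
  have h := Finset.sum_le_sum (fun a (_ : a ∈ Finset.univ) => ht a)
  rw [Finset.sum_sub_distrib, Finset.sum_add_distrib, ← Finset.mul_sum, ← Finset.mul_sum,
    ← Finset.mul_sum, hs, mul_zero, add_zero] at h
  exact h
end

section
/- Fix an integer K ≥ 1, a probability vector q on Fin K, and an index a ∈ Fin K with q(a) < 1. Then H(q) ≤ (1 − q(a))·log(e·K/(1 − q(a))), where e is Euler's number. -/
open Finset

/-- Shannon entropy `H(q) = ∑ a, q a * log (1 / q a)`.
(In Lean, `0 * Real.log (1 / 0) = 0` automatically, matching the convention.) -/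
noncomputable def shannonEntropy {K : ℕ} (q : Fin K → ℝ) : ℝ :=
  ∑ a, q a * Real.log (1 / q a)

/-- Per-round entropy bound: `H(q) ≤ (1 − q a)·log(e·K/(1 − q a))`. -/
theorem entropy_le_offmass_log
    (K : ℕ) (hK : 1 ≤ K) (q : Fin K → ℝ) (hq : IsProbVec q)
    (a : Fin K) (ha : q a < 1) :
    shannonEntropy q
      ≤ (1 - q a) * Real.log (Real.exp 1 * K / (1 - q a)) := by
  obtain ⟨h0, h1⟩ := hq
  have hs : 0 < 1 - q a := by linarith
  have hKpos : (0 : ℝ) < K := by exact_mod_cast hK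
  have key : ∀ c : ℝ, 0 < c → ∀ x : ℝ, 0 ≤ x →
      x * Real.log (1 / x) ≤ x * Real.log (1 / c) + (c - x) := by
    intro c hc x hx
    rcases hx.eq_or_lt with rfl | hx
    · simpa using hc.le
    · have h := Real.log_le_sub_one_of_pos (div_pos hc hx)
      rw [Real.log_div hc.ne' hx.ne'] at h
      have h2 := mul_le_mul_of_nonneg_left h hx.le
      have h3 : x * (c / x - 1) = c - x := by field_simp
      rw [h3] at h2
      simp only [one_div, Real.log_inv]
      linarith
  have hsum : ∑ i ∈ univ.erase a, q i = 1 - q a := by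
    have := Finset.add_sum_erase univ q (mem_univ a)
    linarith
  have hA : q a * Real.log (1 / q a) ≤ 1 - q a := by
    simpa using key 1 one_pos (q a) (h0 a)
  have hB : ∑ i ∈ univ.erase a, q i * Real.log (1 / q i)
      ≤ (1 - q a) * Real.log (1 / ((1 - q a) / K)) := by
    calc _ ≤ ∑ i ∈ univ.erase a, (q i * Real.log (1 / ((1 - q a) / K)) + ((1 - q a) / K - q i)) :=
          Finset.sum_le_sum fun i _ => key _ (div_pos hs hKpos) _ (h0 i)
      _ = (1 - q a) * Real.log (1 / ((1 - q a) / K))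
            + (((univ.erase a).card : ℝ) * ((1 - q a) / K) - (1 - q a)) := by
          rw [Finset.sum_add_distrib, Finset.sum_sub_distrib, ← Finset.sum_mul, hsum,
            Finset.sum_const, nsmul_eq_mul]
      _ ≤ _ := by
          have hc : ((univ.erase a).card : ℝ) ≤ K := by
            have := Finset.card_le_univ (univ.erase a)
            rw [Fintype.card_fin] at this
            exact_mod_cast this
          have h := mul_le_mul_of_nonneg_right hc (div_pos hs hKpos).le
          have h3 : (K : ℝ) * ((1 - q a) / K) = 1 - q a := by field_simp
          linarith
  have hR : Real.log (Real.exp 1 * K / (1 - q a)) = 1 + Real.log (1 / ((1 - q a) / K)) := by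
    rw [one_div_div, mul_div_assoc, Real.log_mul (Real.exp_pos 1).ne' (div_pos hKpos hs).ne',
      Real.log_exp]
  unfold shannonEntropy
  rw [← Finset.add_sum_erase univ _ (mem_univ a), hR]
  linarith
end

section
/- Fix integers K ≥ 1 and T ≥ 1, probability vectors q_1, …, q_T on Fin K, and an index a ∈ Fin K. Set Q = Σ_{t=1}^T (1 − q_t(a)) and suppose Q > 0. Then Σ_{t=1}^T H(q_t) ≤ Q·log(e·K·T/Q), where e is Euler's number. -/
open Finset

lemma ent_aux (x c : ℝ) (hx : 0 ≤ x) (hc : 0 < c) :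
    x * Real.log (1 / x) ≤ x * Real.log (1 / c) + c - x := by
  rcases hx.eq_or_lt with h | h
  · subst h; simp; exact hc.le
  · have h1 := Real.log_le_sub_one_of_pos (div_pos hc h)
    rw [Real.log_div hc.ne' h.ne'] at h1
    have h2 := mul_le_mul_of_nonneg_left h1 h.le
    have h3 : x * (c / x - 1) = c - x := by field_simp
    rw [h3] at h2
    simp only [one_div, Real.log_inv]
    linarith

lemma ent_one (K : ℕ) (q : Fin K → ℝ) (hq : IsProbVec q) (a : Fin K) (c : ℝ) (hc : 0 < c) :
    shannonEntropy q ≤ (1 - q a) * Real.log (1 / c) + K * c := by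
  obtain ⟨h0, h1⟩ := hq
  unfold shannonEntropy
  rw [← Finset.add_sum_erase _ _ (Finset.mem_univ a)] at h1 ⊢
  have ha := ent_aux (q a) 1 (h0 a) one_pos
  have hb : ∑ b ∈ Finset.univ.erase a, q b * Real.log (1 / q b)
      ≤ ∑ b ∈ Finset.univ.erase a, (q b * Real.log (1 / c) + c - q b) :=
    Finset.sum_le_sum fun b _ => ent_aux _ _ (h0 b) hc
  rw [Finset.sum_sub_distrib, Finset.sum_add_distrib, ← Finset.sum_mul] at hb
  have hcard : ∑ b ∈ Finset.univ.erase a, c ≤ K * c := by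
    calc _ ≤ ∑ b : Fin K, c :=
          Finset.sum_le_sum_of_subset_of_nonneg (Finset.erase_subset _ _) fun _ _ _ => hc.le
      _ = K * c := by simp
  have hd : ∑ b ∈ Finset.univ.erase a, q b = 1 - q a := by linarith
  rw [hd] at hb
  simp only [div_one, Real.log_one, mul_zero, zero_add] at ha
  linarith

/-- Lemma 13 of the paper: the total entropy of a sequence of distributions is
controlled by the total mass `Q` placed off a fixed arm `a`:
`∑ t, H(q t) ≤ Q·log(e·K·T/Q)`. -/
theorem total_entropy_le
    (K T : ℕ) (hK : 1 ≤ K) (hT : 1 ≤ T)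
    (q : Fin T → Fin K → ℝ) (hq : ∀ t, IsProbVec (q t)) (a : Fin K)
    (Q : ℝ) (hQ : Q = ∑ t, (1 - q t a)) (hQpos : 0 < Q) :
    ∑ t, shannonEntropy (q t) ≤ Q * Real.log (Real.exp 1 * K * T / Q) := by
  have hK' : (0 : ℝ) < K := by exact_mod_cast hK
  have hT' : (0 : ℝ) < T := by exact_mod_cast hT
  have hc : 0 < Q / (K * T) := by positivity
  calc ∑ t, shannonEntropy (q t)
      ≤ ∑ t, ((1 - q t a) * Real.log (1 / (Q / (K * T))) + K * (Q / (K * T))) :=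
        Finset.sum_le_sum fun t _ => ent_one K (q t) (hq t) a _ hc
    _ = Q * Real.log (1 / (Q / (K * T))) + Q := by
        rw [Finset.sum_add_distrib, ← Finset.sum_mul, ← hQ]
        simp only [Finset.sum_const, Finset.card_univ, Fintype.card_fin, nsmul_eq_mul]
        congr 1
        field_simp
    _ = Q * Real.log (Real.exp 1 * K * T / Q) := by
        have : Real.exp 1 * K * T / Q = Real.exp 1 * (1 / (Q / (K * T))) := by field_simp
        rw [this, Real.log_mul (Real.exp_pos 1).ne' (by positivity), Real.log_exp]
        ring
end

section
/- Fix an integer T ≥ 1, reals β₁ > 0 and c > 0, and nonnegative reals H_1, …, H_T. Define S_t = Σ_{s=1}^t H_s and define the sequence (β_t) recursively by β_{t+1} = β_t + β₁/√(1 + S_t/c) for t = 1, …, T. Then Σ_{t=1}^T 1/β_t ≤ ((1 + log T)/β₁)·√(1 + S_T/c). -/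
open Finset

/-- Bound on the sum of inverse adaptive learning rates: if
`β 1 = β₁` and `β (t+1) = β t + β₁ / √(1 + S t / c)` with `S t = ∑_{s=1}^t H s`
and `H s ≥ 0`, then `∑_{t=1}^T 1/β t ≤ ((1 + log T)/β₁)·√(1 + S T / c)`. -/
theorem sum_inv_adaptive_rate_le
    (T : ℕ) (hT : 1 ≤ T) (β₁ c : ℝ) (hβ₁ : 0 < β₁) (hc : 0 < c)
    (H : ℕ → ℝ) (hH : ∀ s, 1 ≤ s → s ≤ T → 0 ≤ H s)
    (S : ℕ → ℝ) (hS : ∀ t, S t = ∑ s ∈ Finset.Icc 1 t, H s)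
    (β : ℕ → ℝ) (hβ1 : β 1 = β₁)
    (hβrec : ∀ t, 1 ≤ t → t ≤ T → β (t + 1) = β t + β₁ / Real.sqrt (1 + S t / c)) :
    ∑ t ∈ Finset.Icc 1 T, 1 / β t
      ≤ ((1 + Real.log T) / β₁) * Real.sqrt (1 + S T / c) := by
  have hS0 : ∀ t, t ≤ T → 0 ≤ S t := by
    intro t ht
    rw [hS]
    apply Finset.sum_nonneg
    intro s hs
    rw [Finset.mem_Icc] at hs
    exact hH s hs.1 (hs.2.trans ht)
  have hSm : ∀ t, t ≤ T → S t ≤ S T := by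
    intro t ht
    rw [hS, hS]
    apply Finset.sum_le_sum_of_subset_of_nonneg
    · exact Finset.Icc_subset_Icc_right ht
    · intro s hs _
      rw [Finset.mem_Icc] at hs
      exact hH s hs.1 hs.2
  have hge1 : ∀ t, t ≤ T → 1 ≤ Real.sqrt (1 + S t / c) := by
    intro t ht
    rw [Real.one_le_sqrt]
    have := div_nonneg (hS0 t ht) hc.le
    linarith
  have hRm : ∀ t, t ≤ T → Real.sqrt (1 + S t / c) ≤ Real.sqrt (1 + S T / c) := by
    intro t ht
    apply Real.sqrt_le_sqrt
    have := div_le_div_of_nonneg_right (hSm t ht) hc.le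
    linarith
  have hR1 := hge1 T le_rfl
  set R := Real.sqrt (1 + S T / c) with hR
  have hR0 : 0 < R := by linarith
  have key : ∀ t, 1 ≤ t → t ≤ T → (t : ℝ) * (β₁ / R) ≤ β t := by
    intro t ht
    induction t, ht using Nat.le_induction with
    | base =>
      intro _
      rw [hβ1, Nat.cast_one, one_mul]
      exact div_le_self hβ₁.le hR1
    | succ t ht ih =>
      intro h
      have h' : t ≤ T := by omega
      rw [hβrec t ht h']
      have h1 := ih h'
      have h2 : β₁ / R ≤ β₁ / Real.sqrt (1 + S t / c) :=
        div_le_div_of_nonneg_left hβ₁.le (by linarith [hge1 t h']) (hRm t h')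
      push_cast
      linarith
  have hharm : ∑ t ∈ Finset.Icc 1 T, ((t : ℝ))⁻¹ ≤ 1 + Real.log T := by
    have h := harmonic_le_one_add_log T
    rw [harmonic_eq_sum_Icc] at h
    push_cast at h
    exact h
  calc ∑ t ∈ Finset.Icc 1 T, 1 / β t
      ≤ ∑ t ∈ Finset.Icc 1 T, (t : ℝ)⁻¹ * (R / β₁) := by
        apply Finset.sum_le_sum
        intro t ht
        rw [Finset.mem_Icc] at ht
        have ht0 : (0 : ℝ) < t := by exact_mod_cast ht.1
        have := one_div_le_one_div_of_le (by positivity) (key t ht.1 ht.2)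
        refine this.trans (le_of_eq ?_)
        field_simp
    _ = (∑ t ∈ Finset.Icc 1 T, (t : ℝ)⁻¹) * (R / β₁) := by rw [Finset.sum_mul]
    _ ≤ (1 + Real.log T) * (R / β₁) := by gcongr
    _ = ((1 + Real.log T) / β₁) * R := by ring
end

section
/- Fix an integer T ≥ 1 and reals β₁ > 0 and c > 0. Let H_1, …, H_{T+1} be nonnegative reals with H_1 = c and H_t ≤ c for all t ∈ {1, …, T+1}. Define S_t = Σ_{s=1}^t H_s and define the sequence (β_t) recursively by β_{t+1} = β_t + β₁/√(1 + S_t/c) for t = 1, …, T. Then Σ_{t=1}^T (β_{t+1} − β_t)·H_{t+1} ≤ 2·β₁·√c·√(S_T). -/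
open Finset

lemma step_aux (b c S h : ℝ) (hb : 0 < b) (hc : 0 < c) (hS : 0 ≤ S) (h0 : 0 ≤ h) (h1 : h ≤ c) :
    b / Real.sqrt (1 + S / c) * h
      ≤ 2 * b * Real.sqrt c * (Real.sqrt (S + h) - Real.sqrt S) := by
  have e : 1 + S / c = (c + S) / c := by field_simp
  rw [e, Real.sqrt_div (by linarith)]
  have hr : 0 < Real.sqrt (c + S) := Real.sqrt_pos.mpr (by linarith)
  have hq : 0 < Real.sqrt c := Real.sqrt_pos.mpr hc
  have a1 : Real.sqrt (S + h) ≤ Real.sqrt (c + S) := Real.sqrt_le_sqrt (by linarith)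
  have a2 : Real.sqrt S ≤ Real.sqrt (S + h) := Real.sqrt_le_sqrt (by linarith)
  have s1 := Real.sq_sqrt (show 0 ≤ S + h by linarith)
  have s2 := Real.sq_sqrt hS
  have key : h ≤ 2 * Real.sqrt (c + S) * (Real.sqrt (S + h) - Real.sqrt S) := by
    nlinarith [mul_nonneg (sub_nonneg.mpr a2) (sub_nonneg.mpr a1),
      mul_nonneg (sub_nonneg.mpr a2) (sub_nonneg.mpr (a2.trans a1))]
  have e2 : b / (Real.sqrt (c + S) / Real.sqrt c) * h
      = (b * Real.sqrt c * h) / Real.sqrt (c + S) := by field_simp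
  rw [e2, div_le_iff₀ hr]
  have := mul_le_mul_of_nonneg_left key (mul_pos hb hq).le
  linarith

/-- Telescoping bound on the FTRL penalty term with adaptive learning rates:
if `H 1 = c`, `0 ≤ H t ≤ c` for `t ∈ {1, …, T+1}`, `S t = ∑_{s=1}^t H s`, and
`β (t+1) = β t + β₁ / √(1 + S t / c)` for `t ∈ {1, …, T}`, then
`∑_{t=1}^T (β (t+1) − β t)·H (t+1) ≤ 2·β₁·√c·√(S T)`. -/
theorem penalty_telescoping_bound
    (T : ℕ) (hT : 1 ≤ T) (β₁ c : ℝ) (hβ₁ : 0 < β₁) (hc : 0 < c)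
    (H : ℕ → ℝ) (hHnonneg : ∀ t, 1 ≤ t → t ≤ T + 1 → 0 ≤ H t)
    (hH1 : H 1 = c) (hHle : ∀ t, 1 ≤ t → t ≤ T + 1 → H t ≤ c)
    (S : ℕ → ℝ) (hS : ∀ t, S t = ∑ s ∈ Finset.Icc 1 t, H s)
    (β : ℕ → ℝ) (hβ1 : β 1 = β₁)
    (hβrec : ∀ t, 1 ≤ t → t ≤ T → β (t + 1) = β t + β₁ / Real.sqrt (1 + S t / c)) :
    ∑ t ∈ Finset.Icc 1 T, (β (t + 1) - β t) * H (t + 1)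
      ≤ 2 * β₁ * Real.sqrt c * Real.sqrt (S T) := by
  have Ssucc : ∀ t, S (t + 1) = S t + H (t + 1) := by
    intro t
    rw [hS, hS, Finset.sum_Icc_succ_top (by omega)]
  have Snn : ∀ t, t ≤ T + 1 → 0 ≤ S t := by
    intro t ht
    rw [hS]
    refine Finset.sum_nonneg fun s hs => ?_
    rw [Finset.mem_Icc] at hs
    exact hHnonneg s hs.1 (hs.2.trans ht)
  have main : ∀ n, n ≤ T → ∑ t ∈ Finset.Icc 1 n, (β (t + 1) - β t) * H (t + 1)
      ≤ 2 * β₁ * Real.sqrt c * (Real.sqrt (S (n + 1)) - Real.sqrt c) := by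
    intro n
    induction n with
    | zero => intro _; simp [hS, hH1]
    | succ k ih =>
      intro hk
      rw [Finset.sum_Icc_succ_top (by omega), hβrec (k + 1) (by omega) hk, Ssucc (k + 1)]
      have h1 := ih (by omega)
      have h2 := step_aux β₁ c (S (k + 1)) (H (k + 1 + 1)) hβ₁ hc (Snn _ (by omega))
        (hHnonneg _ (by omega) (by omega)) (hHle _ (by omega) (by omega))
      rw [add_sub_cancel_left]
      linarith
  refine (main T le_rfl).trans ?_
  have hT1 : Real.sqrt (S (T + 1)) ≤ Real.sqrt (S T) + Real.sqrt c := by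
    refine Real.sqrt_le_iff.mpr ⟨by positivity, ?_⟩
    have := hHle (T + 1) (by omega) le_rfl
    rw [Ssucc]
    nlinarith [Real.sq_sqrt (Snn T (by omega)), Real.sq_sqrt hc.le,
      mul_nonneg (Real.sqrt_nonneg (S T)) (Real.sqrt_nonneg c)]
  exact mul_le_mul_of_nonneg_left (by linarith) (by positivity)
end

section
/- Let R, Q, a, Δ, C be real numbers with Q ≥ 0, a ≥ 0, Δ > 0, and C ≥ 0. Suppose R ≤ a·√Q and R ≥ Δ·Q − C. Then R ≤ a²/Δ + a·√(C/Δ). -/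
/-- Optimized self-bounding bound: if `R ≤ a·√Q` and `R ≥ Δ·Q − C`, then
`R ≤ a²/Δ + a·√(C/Δ)`. -/
theorem self_bounding_optimized
    (R Q a Δ C : ℝ) (hQ : 0 ≤ Q) (ha : 0 ≤ a) (hΔ : 0 < Δ) (hC : 0 ≤ C)
    (hupper : R ≤ a * Real.sqrt Q) (hlower : Δ * Q - C ≤ R) :
    R ≤ a ^ 2 / Δ + a * Real.sqrt (C / Δ) := by
  have hs := Real.sqrt_nonneg Q
  have hs2 := Real.sq_sqrt hQ
  have ht := Real.sqrt_nonneg (C / Δ)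
  have ht2 := Real.sq_sqrt (div_nonneg hC hΔ.le)
  have hu : 0 ≤ a / Δ := div_nonneg ha hΔ.le
  have hua : Δ * (a / Δ) = a := by field_simp
  have hCt : Δ * (C / Δ) = C := by field_simp
  have hgoal : a ^ 2 / Δ = a * (a / Δ) := by ring
  rw [← ht2] at hCt
  generalize Real.sqrt Q = s at *
  generalize Real.sqrt (C / Δ) = t at *
  generalize a / Δ = u at *
  have key : s ^ 2 - t ^ 2 ≤ u * s := by
    have h : Δ * (s ^ 2 - t ^ 2) ≤ Δ * (u * s) := by
      calc Δ * (s ^ 2 - t ^ 2) = Δ * Q - C := by rw [hs2, mul_sub, hCt]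
        _ ≤ a * s := hlower.trans hupper
        _ = Δ * (u * s) := by rw [← mul_assoc, hua]
    exact le_of_mul_le_mul_left h hΔ
  have hst : s ≤ u + t := by
    by_contra! h
    nlinarith [mul_pos (show 0 < s by linarith) (show 0 < s - u - t by linarith),
      mul_nonneg ht (show 0 ≤ s - t by linarith)]
  calc R ≤ a * s := hupper
    _ ≤ a * (u + t) := mul_le_mul_of_nonneg_left hst ha
    _ = a ^ 2 / Δ + a * t := by rw [hgoal]; ring
end

section
/- Fix integers K ≥ 1 and T ≥ 1 and positive reals β_1, …, β_{T+1}. Let ℓ_1, …, ℓ_T : Fin K → ℝ be arbitrary loss vectors. For t = 1, …, T+1 define the probability vector q_t on Fin K by q_t(a) = exp(−(Σ_{s=1}^{t−1} ℓ_s(a))/β_t) / Σ_b exp(−(Σ_{s=1}^{t−1} ℓ_s(b))/β_t) (so q_1 is the uniform distribution). Then for every probability vector π on Fin K: Σ_{t=1}^T Σ_a ℓ_t(a)·(q_t(a) − π(a)) ≤ Σ_{t=1}^T [ Σ_a ℓ_t(a)·(q_t(a) − q_{t+1}(a)) − β_t·KL(q_{t+1}‖q_t) + (β_{t+1} − β_t)·H(q_{t+1})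 ] + β_1·log K. -/
open Finset

/-- The deterministic core of Lemma 5 (standard FTRL regret decomposition):
for FTRL iterates `q t` with negative-entropy regularizer `ψ_t(q) = −β t·H(q)`,
the regret against any probability vector `π` decomposes into stability and
penalty terms plus `β 1·log K`. -/
theorem ftrl_regret_decomposition
    (K T : ℕ) (hK : 1 ≤ K) (hT : 1 ≤ T)
    (β : ℕ → ℝ) (hβ : ∀ t, 1 ≤ t → t ≤ T + 1 → 0 < β t)
    (ℓ : ℕ → Fin K → ℝ)
    (q : ℕ → Fin K → ℝ)
    (hq : ∀ t, 1 ≤ t → t ≤ T + 1 → ∀ a,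
      q t a = Real.exp (-(∑ s ∈ Finset.Icc 1 (t - 1), ℓ s a) / β t) /
        ∑ b, Real.exp (-(∑ s ∈ Finset.Icc 1 (t - 1), ℓ s b) / β t))
    (π : Fin K → ℝ) (hπ : IsProbVec π) :
    ∑ t ∈ Finset.Icc 1 T, ∑ a, ℓ t a * (q t a - π a)
      ≤ (∑ t ∈ Finset.Icc 1 T,
          ((∑ a, ℓ t a * (q t a - q (t + 1) a)) - β t * klDiv (q (t + 1)) (q t)
            + (β (t + 1) - β t) * shannonEntropy (q (t + 1))))
        + β 1 * Real.log K := by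
  obtain ⟨L, hL⟩ : ∃ L : ℕ → Fin K → ℝ, L = fun t a => ∑ s ∈ Finset.Icc 1 (t - 1), ℓ s a :=
    ⟨_, rfl⟩
  obtain ⟨Z, hZ⟩ : ∃ Z : ℕ → ℝ, Z = fun t => ∑ b, Real.exp (-(L t b) / β t) := ⟨_, rfl⟩
  obtain ⟨F, hF⟩ : ∃ F : ℕ → ℝ, F = fun t => -(β t * Real.log (Z t)) := ⟨_, rfl⟩
  have hq' : ∀ t, 1 ≤ t → t ≤ T + 1 → ∀ a, q t a = Real.exp (-(L t a) / β t) / Z t := by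
    intro t h1 h2 a
    rw [hq t h1 h2 a, hZ, hL]
  haveI : Nonempty (Fin K) := ⟨⟨0, hK⟩⟩
  have hZpos : ∀ t, 0 < Z t := by
    intro t
    rw [hZ]
    exact Finset.sum_pos (fun _ _ => Real.exp_pos _) Finset.univ_nonempty
  have hqpos : ∀ t, 1 ≤ t → t ≤ T + 1 → ∀ a, 0 < q t a := by
    intro t h1 h2 a
    rw [hq' t h1 h2 a]
    exact div_pos (Real.exp_pos _) (hZpos t)
  have hqsum : ∀ t, 1 ≤ t → t ≤ T + 1 → ∑ a, q t a = 1 := by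
    intro t h1 h2
    rw [Finset.sum_congr rfl (fun a _ => hq' t h1 h2 a), ← Finset.sum_div,
      div_eq_one_iff_eq (hZpos t).ne', hZ]
  have hlog : ∀ t, 1 ≤ t → t ≤ T + 1 → ∀ a, β t * Real.log (q t a) = F t - L t a := by
    intro t h1 h2 a
    have hb := (hβ t h1 h2).ne'
    rw [hq' t h1 h2 a, Real.log_div (Real.exp_pos _).ne' (hZpos t).ne', Real.log_exp, hF]
    field_simp
    ring
  have hLs : ∀ t, 1 ≤ t → ∀ a, L (t + 1) a = L t a + ℓ t a := by
    intro t h1 a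
    obtain ⟨k, rfl⟩ : ∃ k, t = k + 1 := ⟨t - 1, by omega⟩
    simp only [hL, Nat.add_sub_cancel]
    rw [Finset.sum_Icc_succ_top (by omega)]
  have hterm : ∀ t ∈ Finset.Icc 1 T,
      ((∑ a, ℓ t a * (q t a - q (t + 1) a)) - β t * klDiv (q (t + 1)) (q t)
            + (β (t + 1) - β t) * shannonEntropy (q (t + 1)))
        = (∑ a, ℓ t a * q t a) + (F t - F (t + 1)) := by
    intro t ht
    rw [Finset.mem_Icc] at ht
    have e : F t - F (t + 1) = ∑ a, q (t + 1) a * (F t - F (t + 1)) := by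
      rw [← Finset.sum_mul, hqsum (t + 1) (by omega) (by omega), one_mul]
    rw [e]
    unfold klDiv shannonEntropy
    rw [Finset.mul_sum, Finset.mul_sum, ← Finset.sum_sub_distrib, ← Finset.sum_add_distrib,
      ← Finset.sum_add_distrib]
    refine Finset.sum_congr rfl (fun a _ => ?_)
    have p1 := hqpos t (by omega) (by omega) a
    have p2 := hqpos (t + 1) (by omega) (by omega) a
    have l1 := hlog t (by omega) (by omega) a
    have l2 := hlog (t + 1) (by omega) (by omega) a
    rw [hLs t ht.1 a] at l2
    rw [Real.log_div p2.ne' p1.ne', one_div, Real.log_inv]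
    linear_combination q (t + 1) a * l1 - q (t + 1) a * l2
  rw [Finset.sum_congr rfl hterm, Finset.sum_add_distrib]
  have htel : ∀ n : ℕ, ∑ t ∈ Finset.Icc 1 n, (F t - F (t + 1)) = F 1 - F (n + 1) := by
    intro n
    induction n with
    | zero => simp
    | succ k ih => rw [Finset.sum_Icc_succ_top (by omega), ih]; ring
  have hF1 : F 1 = -(β 1 * Real.log K) := by
    simp [hF, hZ, hL]
  have hmin : ∀ a, F (T + 1) ≤ L (T + 1) a := by
    intro a
    have hb := hβ (T + 1) (by omega) le_rfl
    have h1 : Real.exp (-(L (T + 1) a) / β (T + 1)) ≤ Z (T + 1) := by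
      rw [hZ]
      exact Finset.single_le_sum (f := fun b => Real.exp (-(L (T + 1) b) / β (T + 1)))
        (fun _ _ => (Real.exp_pos _).le) (Finset.mem_univ a)
    have h2 := (Real.le_log_iff_exp_le (hZpos _)).2 h1
    rw [div_le_iff₀ hb] at h2
    simp only [hF]
    linarith
  have hcmp : F (T + 1) ≤ ∑ a, π a * L (T + 1) a := by
    calc F (T + 1) = ∑ a, π a * F (T + 1) := by rw [← Finset.sum_mul, hπ.2, one_mul]
      _ ≤ _ := Finset.sum_le_sum (fun a _ => mul_le_mul_of_nonneg_left (hmin a) (hπ.1 a))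
  have hswap : ∑ t ∈ Finset.Icc 1 T, ∑ a, ℓ t a * π a = ∑ a, π a * L (T + 1) a := by
    rw [Finset.sum_comm]
    refine Finset.sum_congr rfl (fun a _ => ?_)
    simp only [hL, Nat.add_sub_cancel]
    rw [← Finset.sum_mul, mul_comm]
  rw [htel, hF1]
  simp only [mul_sub, Finset.sum_sub_distrib]
  rw [hswap]
  linarith
end
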